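/- arXiv:2512.07986 — 8 statements merged into one kernel-verified Lean document; each statement's English description precedes it below -/
import Mathlib

section
/- Let k₁,k₂,l₁ ≥ 1 and l₂ ≥ 0 be integers and set d₁ = k₁+k₂+l₂k₁k₂, d₂ = l₁k₁k₂, m₂ = l₁k₁, n = l₁+l₂+1. Let g₁,g₂ ∈ ℂ[t] with deg gᵢ ≤ lᵢ, write gᵢ(t) = Σ_{j=0}^{lᵢ} c_{i,j} t^j, and define the bivariate polynomials Gᵢ(x,y) = Σ_{j=0}^{lᵢ} c_{i,j} y^{k₂ j} x^{k₁(lᵢ−j)}. Suppose there is μ ∈ ℂ such that m₂·g₁g₂ − d₁·t·g₁′·g₂ + d₂·t·g₁·g₂′ = μ·(t−1)^{n−1} in ℂ[t]. Then the polynomials u = G₁(x,y) and v = x·y·G₂(x,y) satisfy J(u,v) = μ·(y^{k₂} − x^{k₁})^{n−1}. -/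
open Polynomial in
/-- The homogenization of `p` in degree `n`, evaluated at `(y ^ k₂, x ^ k₁)`: the polynomial
`∑ j ≤ n, pⱼ y ^ (k₂ j) x ^ (k₁ (n - j))`. -/
noncomputable def weightedHomogenize {R : Type*} [CommSemiring R] (k₁ k₂ n : ℕ) (p : R[X]) :
    MvPolynomial (Fin 2) R :=
  MvPolynomial.aeval ![MvPolynomial.X 1 ^ k₂, MvPolynomial.X 0 ^ k₁] (p.homogenize n)

section WeightedHomogenize

open MvPolynomial

variable {R : Type*}

theorem weightedHomogenize_eq_sum [CommSemiring R] (k₁ k₂ n : ℕ) (p : Polynomial R) :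
    weightedHomogenize k₁ k₂ n p = ∑ j ∈ Finset.range (n + 1),
      C (p.coeff j) * X 1 ^ (k₂ * j) * X 0 ^ (k₁ * (n - j)) := by
  rw [weightedHomogenize, Polynomial.homogenize,
    Finset.Nat.sum_antidiagonal_eq_sum_range_succ_mk, map_sum]
  refine Finset.sum_congr rfl fun j _ ↦ ?_
  rw [Finsupp.update_eq_add_single (by simp), aeval_monomial,
    Finsupp.prod_add_index' (by simp) (by simp [pow_add]), Finsupp.prod_single_index (by simp),
    Finsupp.prod_single_index (by simp)]
  simp [pow_mul, mul_assoc, algebraMap_eq]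

theorem weightedHomogenize_mul [CommSemiring R] (k₁ k₂ : ℕ) {m n : ℕ} {p q : Polynomial R}
    (hp : p.natDegree ≤ m) (hq : q.natDegree ≤ n) :
    weightedHomogenize k₁ k₂ (m + n) (p * q) =
      weightedHomogenize k₁ k₂ m p * weightedHomogenize k₁ k₂ n q := by
  simp [weightedHomogenize, Polynomial.homogenize_mul p q hp hq]

theorem weightedHomogenize_add [CommSemiring R] (k₁ k₂ n : ℕ) (p q : Polynomial R) :
    weightedHomogenize k₁ k₂ n (p + q) =
      weightedHomogenize k₁ k₂ n p + weightedHomogenize k₁ k₂ n q := by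
  simp [weightedHomogenize]

theorem weightedHomogenize_sub [CommRing R] (k₁ k₂ n : ℕ) (p q : Polynomial R) :
    weightedHomogenize k₁ k₂ n (p - q) =
      weightedHomogenize k₁ k₂ n p - weightedHomogenize k₁ k₂ n q := by
  simp [weightedHomogenize]

theorem weightedHomogenize_C_mul [CommSemiring R] (k₁ k₂ n : ℕ) (c : R) (p : Polynomial R) :
    weightedHomogenize k₁ k₂ n (Polynomial.C c * p) = C c * weightedHomogenize k₁ k₂ n p := by
  simp [weightedHomogenize, algebraMap_eq]

theorem weightedHomogenize_X_sub_one_pow [CommRing R] (k₁ k₂ n : ℕ) :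
    weightedHomogenize k₁ k₂ n ((Polynomial.X - 1 : Polynomial R) ^ n) =
      (X 1 ^ k₂ - X 0 ^ k₁) ^ n := by
  induction n with
  | zero => simp [weightedHomogenize]
  | succ n ih =>
    have h : (Polynomial.X - 1 : Polynomial R).natDegree ≤ 1 := by
      simpa using Polynomial.natDegree_X_sub_C_le (1 : R)
    rw [pow_succ, weightedHomogenize_mul k₁ k₂
      (by simpa using Polynomial.natDegree_pow_le_of_le n h) h, ih, pow_succ]
    simp [weightedHomogenize]

theorem MvPolynomial.X_mul_pderiv_X_pow {σ : Type*} [CommSemiring R] (i : σ) (n : ℕ) :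
    X i * pderiv i (X i ^ n) = (n : MvPolynomial σ R) * X i ^ n := by
  rcases n with _ | n
  · simp
  · rw [pderiv_pow, pderiv_X_self, Nat.add_sub_cancel, pow_succ]
    ring

theorem natDegree_X_mul_derivative_le [Semiring R] {n : ℕ} {p : Polynomial R}
    (hp : p.natDegree ≤ n) : (Polynomial.X * p.derivative).natDegree ≤ n := by
  refine Polynomial.natDegree_le_iff_coeff_eq_zero.2 fun j hj ↦ ?_
  rcases j with _ | j
  · simp
  · rw [Polynomial.coeff_X_mul, Polynomial.coeff_derivative,
      Polynomial.coeff_eq_zero_of_natDegree_lt (hp.trans_lt hj), zero_mul]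

theorem coeff_X_mul_derivative [CommSemiring R] (p : Polynomial R) (j : ℕ) :
    (Polynomial.X * p.derivative).coeff j = j * p.coeff j := by
  rcases j with _ | j
  · simp
  · rw [Polynomial.coeff_X_mul, Polynomial.coeff_derivative, mul_comm]
    push_cast
    rfl

theorem X_one_mul_pderiv_weightedHomogenize [CommSemiring R] (k₁ k₂ n : ℕ) (p : Polynomial R) :
    X 1 * pderiv 1 (weightedHomogenize k₁ k₂ n p) =
      (k₂ : MvPolynomial (Fin 2) R) *
        weightedHomogenize k₁ k₂ n (Polynomial.X * p.derivative) := by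
  simp only [weightedHomogenize_eq_sum, map_sum, Finset.mul_sum]
  refine Finset.sum_congr rfl fun j _ ↦ ?_
  have h0 : pderiv 1 (X 0 ^ (k₁ * (n - j)) : MvPolynomial (Fin 2) R) = 0 := by
    rw [pderiv_pow, pderiv_X_of_ne (by decide), mul_zero]
  rw [pderiv_mul, pderiv_C_mul, h0, mul_zero, add_zero, ← mul_assoc, mul_left_comm (X 1),
    X_mul_pderiv_X_pow, coeff_X_mul_derivative, C_mul, map_natCast]
  push_cast
  ring

theorem X_zero_mul_pderiv_weightedHomogenize [CommRing R] (k₁ k₂ n : ℕ) (p : Polynomial R) :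
    X 0 * pderiv 0 (weightedHomogenize k₁ k₂ n p) =
      (k₁ : MvPolynomial (Fin 2) R) * ((n : MvPolynomial (Fin 2) R) *
        weightedHomogenize k₁ k₂ n p -
          weightedHomogenize k₁ k₂ n (Polynomial.X * p.derivative)) := by
  simp only [weightedHomogenize_eq_sum, map_sum, Finset.mul_sum, ← Finset.sum_sub_distrib]
  refine Finset.sum_congr rfl fun j hj ↦ ?_
  have h1 : pderiv 0 (X 1 ^ (k₂ * j) : MvPolynomial (Fin 2) R) = 0 := by
    rw [pderiv_pow, pderiv_X_of_ne (by decide), mul_zero]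
  rw [pderiv_mul, pderiv_C_mul, h1, mul_zero, zero_mul, zero_add, mul_left_comm,
    X_mul_pderiv_X_pow, coeff_X_mul_derivative, C_mul, map_natCast]
  push_cast [Nat.cast_sub (Finset.mem_range_succ_iff.1 hj)]
  ring

end WeightedHomogenize

/-- Case (a) of the main theorem, Jacobian computation: with `u = G₁(x,y)` and
`v = x·y·G₂(x,y)`, the Jacobian `J(u,v)` equals `μ·(y^{k₂} - x^{k₁})^{n-1}`. -/
theorem stmt_1 (k₁ k₂ l₁ l₂ : ℕ) (hk₁ : 1 ≤ k₁) (hk₂ : 1 ≤ k₂) (hl₁ : 1 ≤ l₁)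
    (d₁ d₂ m₂ n : ℕ)
    (hd₁ : d₁ = k₁ + k₂ + l₂ * k₁ * k₂) (hd₂ : d₂ = l₁ * k₁ * k₂)
    (hm₂ : m₂ = l₁ * k₁) (hn : n = l₁ + l₂ + 1)
    (g₁ g₂ : Polynomial ℂ) (hdeg₁ : g₁.natDegree ≤ l₁) (hdeg₂ : g₂.natDegree ≤ l₂)
    (μ : ℂ)
    (hODE : Polynomial.C (m₂ : ℂ) * (g₁ * g₂)
        - Polynomial.C (d₁ : ℂ) * Polynomial.X * Polynomial.derivative g₁ * g₂
        + Polynomial.C (d₂ : ℂ) * Polynomial.X * g₁ * Polynomial.derivative g₂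
        = Polynomial.C μ * (Polynomial.X - 1) ^ (n - 1))
    (G₁ G₂ u v : MvPolynomial (Fin 2) ℂ)
    (hG₁ : G₁ = ∑ j ∈ Finset.range (l₁ + 1),
        MvPolynomial.C (g₁.coeff j) * MvPolynomial.X 1 ^ (k₂ * j)
          * MvPolynomial.X 0 ^ (k₁ * (l₁ - j)))
    (hG₂ : G₂ = ∑ j ∈ Finset.range (l₂ + 1),
        MvPolynomial.C (g₂.coeff j) * MvPolynomial.X 1 ^ (k₂ * j)
          * MvPolynomial.X 0 ^ (k₁ * (l₂ - j)))
    (hu : u = G₁) (hv : v = MvPolynomial.X 0 * MvPolynomial.X 1 * G₂) :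
    MvPolynomial.pderiv 0 u * MvPolynomial.pderiv 1 v
      - MvPolynomial.pderiv 1 u * MvPolynomial.pderiv 0 v
      = MvPolynomial.C μ * (MvPolynomial.X 1 ^ k₂ - MvPolynomial.X 0 ^ k₁) ^ (n - 1) := by
  have hN : n - 1 = l₁ + l₂ := by omega
  have hODE' := congrArg (weightedHomogenize k₁ k₂ (l₁ + l₂)) hODE
  rw [mul_assoc (Polynomial.C _), mul_assoc (Polynomial.C _), mul_assoc (Polynomial.C _),
    mul_assoc (Polynomial.C _), mul_assoc Polynomial.X g₁, mul_left_comm Polynomial.X g₁, hN,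
    weightedHomogenize_add, weightedHomogenize_sub] at hODE'
  simp only [weightedHomogenize_C_mul, weightedHomogenize_X_sub_one_pow] at hODE'
  rw [weightedHomogenize_mul k₁ k₂ hdeg₁ hdeg₂,
    weightedHomogenize_mul k₁ k₂ (natDegree_X_mul_derivative_le hdeg₁) hdeg₂,
    weightedHomogenize_mul k₁ k₂ hdeg₁ (natDegree_X_mul_derivative_le hdeg₂)] at hODE'
  rw [← weightedHomogenize_eq_sum] at hG₁ hG₂
  have hx₁ := X_zero_mul_pderiv_weightedHomogenize k₁ k₂ l₁ g₁
  have hx₂ := X_zero_mul_pderiv_weightedHomogenize k₁ k₂ l₂ g₂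
  have hy₁ := X_one_mul_pderiv_weightedHomogenize k₁ k₂ l₁ g₁
  have hy₂ := X_one_mul_pderiv_weightedHomogenize k₁ k₂ l₂ g₂
  rw [← hG₁] at hx₁ hy₁ hODE'
  rw [← hG₂] at hx₂ hy₂ hODE'
  rw [hu, hv, hN, ← hODE']
  have hxy : (MvPolynomial.X 0 * MvPolynomial.X 1 : MvPolynomial (Fin 2) ℂ) ≠ 0 :=
    mul_ne_zero (MvPolynomial.X_ne_zero 0) (MvPolynomial.X_ne_zero 1)
  refine mul_left_cancel₀ hxy ?_
  simp only [MvPolynomial.pderiv_mul, MvPolynomial.pderiv_X_self, map_natCast,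
    MvPolynomial.pderiv_X_of_ne (show (1 : Fin 2) ≠ 0 by decide),
    MvPolynomial.pderiv_X_of_ne (show (0 : Fin 2) ≠ 1 by decide)]
  subst hd₁ hd₂ hm₂
  push_cast
  generalize MvPolynomial.pderiv 0 G₁ = ux at *
  generalize MvPolynomial.pderiv 1 G₁ = uy at *
  generalize MvPolynomial.pderiv 0 G₂ = vx at *
  generalize MvPolynomial.pderiv 1 G₂ = vy at *
  generalize weightedHomogenize k₁ k₂ l₁ (Polynomial.X * Polynomial.derivative g₁) = D₁ at *
  generalize weightedHomogenize k₁ k₂ l₂ (Polynomial.X * Polynomial.derivative g₂) = D₂ at *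
  generalize (MvPolynomial.X 0 : MvPolynomial (Fin 2) ℂ) = x at *
  generalize (MvPolynomial.X 1 : MvPolynomial (Fin 2) ℂ) = y at *
  linear_combination (x * y * (G₂ + y * vy)) * hx₁ - (x * y * (G₂ + x * vx)) * hy₁
    + x * y * k₁ * (l₁ * G₁ - D₁) * hy₂ - x * y * k₂ * D₁ * hx₂
end

section
/- Let k₁,k₂ ≥ 1 and l₁,l₂ ≥ 0 be integers and set m₁ = k₂l₂+1, m₂ = k₁l₁+1, d₁ = k₁m₁, d₂ = k₂m₂, n = l₁+l₂+1. Let g₁,g₂ ∈ ℂ[t] with deg gᵢ ≤ lᵢ, write gᵢ(t) = Σ_{j=0}^{lᵢ} c_{i,j} t^j, and define the bivariate polynomials Gᵢ(x,y) = Σ_{j=0}^{lᵢ} c_{i,j} y^{k₂ j} x^{k₁(lᵢ−j)}. Suppose there is μ ∈ ℂ such that m₂·g₁g₂ − d₁·t·g₁′·g₂ + d₂·t·g₁·g₂′ = μ·(t−1)^{n−1} in ℂ[t]. Then the polynomials u = x·G₁(x,y) and v = y·G₂(x,y) satisfy J(u,v) = μ·(y^{k₂} − x^{k₁})^{n−1}.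 -/
namespace Polynomial

variable {R : Type*} [CommRing R]

/-- The weighted homogenization of `p`: each `t ^ j` is replaced by
`y ^ (k₂ * j) * x ^ (k₁ * (l - j))`, where `x = X 0` and `y = X 1`. -/
noncomputable def weightedHomogenize (k₁ k₂ l : ℕ) (p : R[X]) : MvPolynomial (Fin 2) R :=
  MvPolynomial.aeval ![.X 1 ^ k₂, .X 0 ^ k₁] (p.homogenize l)

lemma weightedHomogenize_eq_sum (k₁ k₂ l : ℕ) (p : R[X]) :
    weightedHomogenize k₁ k₂ l p = ∑ j ∈ Finset.range (l + 1),
      .C (p.coeff j) * .X 1 ^ (k₂ * j) * .X 0 ^ (k₁ * (l - j)) := by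
  rw [weightedHomogenize, homogenize, Finset.Nat.sum_antidiagonal_eq_sum_range_succ_mk, map_sum]
  refine Finset.sum_congr rfl fun j _ ↦ ?_
  rw [MvPolynomial.aeval_monomial, Finsupp.prod_fintype _ _ (by simp)]
  simp [Fin.prod_univ_two, pow_mul, MvPolynomial.algebraMap_eq, mul_assoc]

lemma weightedHomogenize_add (k₁ k₂ l : ℕ) (p q : R[X]) :
    weightedHomogenize k₁ k₂ l (p + q) =
      weightedHomogenize k₁ k₂ l p + weightedHomogenize k₁ k₂ l q := by
  simp [weightedHomogenize]

lemma weightedHomogenize_sub (k₁ k₂ l : ℕ) (p q : R[X]) :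
    weightedHomogenize k₁ k₂ l (p - q) =
      weightedHomogenize k₁ k₂ l p - weightedHomogenize k₁ k₂ l q := by
  simp [weightedHomogenize]

lemma weightedHomogenize_C_mul (k₁ k₂ l : ℕ) (c : R) (p : R[X]) :
    weightedHomogenize k₁ k₂ l (C c * p) = .C c * weightedHomogenize k₁ k₂ l p := by
  simp [weightedHomogenize, MvPolynomial.algebraMap_eq]

lemma weightedHomogenize_mul (k₁ k₂ : ℕ) {l₁ l₂ : ℕ} {p q : R[X]}
    (hp : p.natDegree ≤ l₁) (hq : q.natDegree ≤ l₂) :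
    weightedHomogenize k₁ k₂ (l₁ + l₂) (p * q) =
      weightedHomogenize k₁ k₂ l₁ p * weightedHomogenize k₁ k₂ l₂ q := by
  simp [weightedHomogenize, homogenize_mul p q hp hq]

lemma weightedHomogenize_X_sub_one_pow (k₁ k₂ n : ℕ) :
    weightedHomogenize k₁ k₂ n ((X - 1 : R[X]) ^ n) =
      (MvPolynomial.X 1 ^ k₂ - .X 0 ^ k₁) ^ n := by
  induction n with
  | zero => simp [weightedHomogenize]
  | succ n ih =>
    rw [pow_succ, weightedHomogenize_mul, ih, pow_succ]
    · simp [weightedHomogenize]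
    · compute_degree
    · compute_degree

lemma X_mul_pderiv_one_weightedHomogenize (k₁ k₂ l : ℕ) (p : R[X]) :
    .X 1 * MvPolynomial.pderiv 1 (weightedHomogenize k₁ k₂ l p) =
      (k₂ : MvPolynomial (Fin 2) R) * weightedHomogenize k₁ k₂ l (X * derivative p) := by
  simp only [weightedHomogenize_eq_sum, map_sum, Finset.mul_sum]
  refine Finset.sum_congr rfl fun j _ ↦ ?_
  have h : MvPolynomial.X 1 * MvPolynomial.pderiv 1 (MvPolynomial.X 1 ^ (k₂ * j)) =
      (k₂ * j * .X 1 ^ (k₂ * j) : MvPolynomial (Fin 2) R) := by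
    rcases Nat.eq_zero_or_pos (k₂ * j) with h | h
    · simp [h, ← Nat.cast_mul]
    · rw [MvPolynomial.pderiv_pow, MvPolynomial.pderiv_X_self, ← mul_pow_sub_one h.ne']
      push_cast
      ring
  have hc : (X * derivative p).coeff j = j * p.coeff j := by
    cases j <;> simp [coeff_X_mul, coeff_derivative, mul_comm]
  simp only [MvPolynomial.pderiv_mul, MvPolynomial.pderiv_C, MvPolynomial.pderiv_pow,
    MvPolynomial.pderiv_X_of_ne (show (0 : Fin 2) ≠ 1 by decide), hc, map_mul, map_natCast] at h ⊢
  linear_combination MvPolynomial.C (p.coeff j) * .X 0 ^ (k₁ * (l - j)) * h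

lemma X_mul_pderiv_zero_weightedHomogenize (k₁ k₂ l : ℕ) (p : R[X]) :
    .X 0 * MvPolynomial.pderiv 0 (weightedHomogenize k₁ k₂ l p) =
      (k₁ : MvPolynomial (Fin 2) R) * ((l : MvPolynomial (Fin 2) R) * weightedHomogenize k₁ k₂ l p -
        weightedHomogenize k₁ k₂ l (X * derivative p)) := by
  simp only [weightedHomogenize_eq_sum, map_sum, Finset.mul_sum, ← Finset.sum_sub_distrib]
  refine Finset.sum_congr rfl fun j hj ↦ ?_
  have hjl : j ≤ l := Nat.lt_succ_iff.mp (Finset.mem_range.mp hj)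
  have h : MvPolynomial.X 0 * MvPolynomial.pderiv 0 (MvPolynomial.X 0 ^ (k₁ * (l - j))) =
      (k₁ * (l - j) * .X 0 ^ (k₁ * (l - j)) : MvPolynomial (Fin 2) R) := by
    rw [← Nat.cast_sub hjl]
    rcases Nat.eq_zero_or_pos (k₁ * (l - j)) with h | h
    · simp [h, ← Nat.cast_mul]
    · rw [MvPolynomial.pderiv_pow, MvPolynomial.pderiv_X_self, ← mul_pow_sub_one h.ne']
      push_cast
      ring
  have hc : (X * derivative p).coeff j = j * p.coeff j := by
    cases j <;> simp [coeff_X_mul, coeff_derivative, mul_comm]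
  simp only [MvPolynomial.pderiv_mul, MvPolynomial.pderiv_C, MvPolynomial.pderiv_pow,
    MvPolynomial.pderiv_X_of_ne (show (1 : Fin 2) ≠ 0 by decide), hc, map_mul, map_natCast] at h ⊢
  linear_combination MvPolynomial.C (p.coeff j) * .X 1 ^ (k₂ * j) * h

lemma natDegree_X_mul_derivative_le (p : R[X]) : (X * derivative p).natDegree ≤ p.natDegree := by
  refine natDegree_le_iff_coeff_eq_zero.mpr fun j hj ↦ ?_
  cases j <;> simp [coeff_X_mul, coeff_derivative, coeff_eq_zero_of_natDegree_lt hj]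

end Polynomial

/-- Case (b) of the main theorem, Jacobian computation: with `u = x·G₁(x,y)` and
`v = y·G₂(x,y)`, the Jacobian `J(u,v)` equals `μ·(y^{k₂} - x^{k₁})^{n-1}`. -/
theorem stmt_2 (k₁ k₂ l₁ l₂ : ℕ) (hk₁ : 1 ≤ k₁) (hk₂ : 1 ≤ k₂)
    (m₁ m₂ d₁ d₂ n : ℕ)
    (hm₁ : m₁ = k₂ * l₂ + 1) (hm₂ : m₂ = k₁ * l₁ + 1)
    (hd₁ : d₁ = k₁ * m₁) (hd₂ : d₂ = k₂ * m₂) (hn : n = l₁ + l₂ + 1)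
    (g₁ g₂ : Polynomial ℂ) (hdeg₁ : g₁.natDegree ≤ l₁) (hdeg₂ : g₂.natDegree ≤ l₂)
    (μ : ℂ)
    (hODE : Polynomial.C (m₂ : ℂ) * (g₁ * g₂)
        - Polynomial.C (d₁ : ℂ) * Polynomial.X * Polynomial.derivative g₁ * g₂
        + Polynomial.C (d₂ : ℂ) * Polynomial.X * g₁ * Polynomial.derivative g₂
        = Polynomial.C μ * (Polynomial.X - 1) ^ (n - 1))
    (G₁ G₂ u v : MvPolynomial (Fin 2) ℂ)
    (hG₁ : G₁ = ∑ j ∈ Finset.range (l₁ + 1),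
        MvPolynomial.C (g₁.coeff j) * MvPolynomial.X 1 ^ (k₂ * j)
          * MvPolynomial.X 0 ^ (k₁ * (l₁ - j)))
    (hG₂ : G₂ = ∑ j ∈ Finset.range (l₂ + 1),
        MvPolynomial.C (g₂.coeff j) * MvPolynomial.X 1 ^ (k₂ * j)
          * MvPolynomial.X 0 ^ (k₁ * (l₂ - j)))
    (hu : u = MvPolynomial.X 0 * G₁) (hv : v = MvPolynomial.X 1 * G₂) :
    MvPolynomial.pderiv 0 u * MvPolynomial.pderiv 1 v
      - MvPolynomial.pderiv 1 u * MvPolynomial.pderiv 0 v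
      = MvPolynomial.C μ * (MvPolynomial.X 1 ^ k₂ - MvPolynomial.X 0 ^ k₁) ^ (n - 1) := by
  have hG₁' : G₁ = g₁.weightedHomogenize k₁ k₂ l₁ := by
    rw [hG₁, Polynomial.weightedHomogenize_eq_sum]
  have hG₂' : G₂ = g₂.weightedHomogenize k₁ k₂ l₂ := by
    rw [hG₂, Polynomial.weightedHomogenize_eq_sum]
  have hx₁ := Polynomial.X_mul_pderiv_zero_weightedHomogenize k₁ k₂ l₁ g₁
  have hy₁ := Polynomial.X_mul_pderiv_one_weightedHomogenize k₁ k₂ l₁ g₁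
  have hx₂ := Polynomial.X_mul_pderiv_zero_weightedHomogenize k₁ k₂ l₂ g₂
  have hy₂ := Polynomial.X_mul_pderiv_one_weightedHomogenize k₁ k₂ l₂ g₂
  have hdeg₁' := (Polynomial.natDegree_X_mul_derivative_le g₁).trans hdeg₁
  have hdeg₂' := (Polynomial.natDegree_X_mul_derivative_le g₂).trans hdeg₂
  have hH : (m₂ : MvPolynomial (Fin 2) ℂ) * (G₁ * G₂)
      - (d₁ : MvPolynomial (Fin 2) ℂ) * ((Polynomial.X * g₁.derivative).weightedHomogenize k₁ k₂ l₁ * G₂)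
      + (d₂ : MvPolynomial (Fin 2) ℂ) * (G₁ * (Polynomial.X * g₂.derivative).weightedHomogenize k₁ k₂ l₂)
      = MvPolynomial.C μ * (MvPolynomial.X 1 ^ k₂ - MvPolynomial.X 0 ^ k₁) ^ (n - 1) := by
    have hn' : n - 1 = l₁ + l₂ := by omega
    have hODE' : Polynomial.C (m₂ : ℂ) * (g₁ * g₂)
        - Polynomial.C (d₁ : ℂ) * (Polynomial.X * g₁.derivative * g₂)
        + Polynomial.C (d₂ : ℂ) * (g₁ * (Polynomial.X * g₂.derivative))
        = Polynomial.C μ * (Polynomial.X - 1) ^ (l₁ + l₂) := by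
      rw [← hn', ← hODE]
      ring
    rw [hG₁', hG₂', hn', ← Polynomial.weightedHomogenize_X_sub_one_pow,
      ← Polynomial.weightedHomogenize_mul k₁ k₂ hdeg₁ hdeg₂,
      ← Polynomial.weightedHomogenize_mul k₁ k₂ hdeg₁' hdeg₂,
      ← Polynomial.weightedHomogenize_mul k₁ k₂ hdeg₁ hdeg₂']
    have := congrArg (Polynomial.weightedHomogenize k₁ k₂ (l₁ + l₂)) hODE'
    simp only [Polynomial.weightedHomogenize_add, Polynomial.weightedHomogenize_sub,
      Polynomial.weightedHomogenize_C_mul] at this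
    simpa only [map_natCast] using this
  rw [← hG₁'] at hx₁ hy₁
  rw [← hG₂'] at hx₂ hy₂
  rw [← hH, hu, hv, hd₁, hd₂, hm₁, hm₂]
  simp only [MvPolynomial.pderiv_mul, MvPolynomial.pderiv_X_self,
    MvPolynomial.pderiv_X_of_ne (show (0 : Fin 2) ≠ 1 by decide),
    MvPolynomial.pderiv_X_of_ne (show (1 : Fin 2) ≠ 0 by decide)]
  push_cast
  simp only [one_mul, zero_mul, zero_add]
  rw [hx₁, hy₂, show ∀ a b c d : MvPolynomial (Fin 2) ℂ, a * b * (c * d) = c * b * (a * d) by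
    intros; ring, hy₁, hx₂]
  ring
end

section
/- Let k₁,k₂,l₁ ≥ 1 and l₂ ≥ 0 be integers and set d₁ = k₁+k₂+l₂k₁k₂, d₂ = l₁k₁k₂. Let g₁,g₂ ∈ ℂ[t] with deg gᵢ ≤ lᵢ and gᵢ(1) = 1, write gᵢ(t) = Σ_{j=0}^{lᵢ} c_{i,j} t^j, and define Gᵢ(x,y) = Σ_{j=0}^{lᵢ} c_{i,j} y^{k₂ j} x^{k₁(lᵢ−j)}, u = G₁(x,y), v = x·y·G₂(x,y). Then for every s ∈ ℂ one has u(s^{k₂}, s^{k₁}) = s^{d₂} and v(s^{k₂}, s^{k₁}) = s^{d₁}; that is, the map F = (u,v) sends the parametrized curve t ↦ (t^{k₂}, t^{k₁}) (the curve x^{k₁} = y^{k₂}) onto the parametrized curve s ↦ (s^{d₂}, s^{d₁}) (the curve u^{d₁} = v^{d₂}). -/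
/-- The homogenization `∑ j, cⱼ y^(k₂ j) x^(k₁ (l - j))` of a polynomial `g` with `g(1) = 1` takes
the value `s^(l k₁ k₂)` at the point `(s^k₂, s^k₁)` of the curve `x^k₁ = y^k₂`. -/
theorem eval_weighted_homogenization {R : Type*} [CommSemiring R] (k₁ k₂ l : ℕ)
    (g : Polynomial R) (hdeg : g.natDegree ≤ l) (hg : g.eval 1 = 1) (s : R) :
    MvPolynomial.eval ![s ^ k₂, s ^ k₁] (∑ j ∈ Finset.range (l + 1),
        MvPolynomial.C (g.coeff j) * MvPolynomial.X 1 ^ (k₂ * j)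
          * MvPolynomial.X 0 ^ (k₁ * (l - j))) = s ^ (l * k₁ * k₂) := by
  have hsum : ∑ j ∈ Finset.range (l + 1), g.coeff j = 1 := by
    simpa [Polynomial.eval_eq_sum_range' (Nat.lt_succ_of_le hdeg)] using hg
  rw [map_sum, ← one_mul (s ^ (l * k₁ * k₂)), ← hsum, Finset.sum_mul]
  refine Finset.sum_congr rfl fun j hj => ?_
  obtain ⟨m, rfl⟩ := Nat.exists_eq_add_of_le (Finset.mem_range_succ_iff.mp hj)
  simp only [map_mul, map_pow, MvPolynomial.eval_C, MvPolynomial.eval_X, Matrix.cons_val_zero,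
    Matrix.cons_val_one, Nat.add_sub_cancel_left]
  ring

/-- Case (a) of the main theorem, branch-curve computation: `F = (u,v)` maps the
parametrized curve `s ↦ (s^{k₂}, s^{k₁})` onto the curve `s ↦ (s^{d₂}, s^{d₁})`. -/
theorem stmt_3 (k₁ k₂ l₁ l₂ : ℕ) (hk₁ : 1 ≤ k₁) (hk₂ : 1 ≤ k₂) (hl₁ : 1 ≤ l₁)
    (d₁ d₂ : ℕ)
    (hd₁ : d₁ = k₁ + k₂ + l₂ * k₁ * k₂) (hd₂ : d₂ = l₁ * k₁ * k₂)
    (g₁ g₂ : Polynomial ℂ) (hdeg₁ : g₁.natDegree ≤ l₁) (hdeg₂ : g₂.natDegree ≤ l₂)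
    (hg₁1 : g₁.eval 1 = 1) (hg₂1 : g₂.eval 1 = 1)
    (G₁ G₂ u v : MvPolynomial (Fin 2) ℂ)
    (hG₁ : G₁ = ∑ j ∈ Finset.range (l₁ + 1),
        MvPolynomial.C (g₁.coeff j) * MvPolynomial.X 1 ^ (k₂ * j)
          * MvPolynomial.X 0 ^ (k₁ * (l₁ - j)))
    (hG₂ : G₂ = ∑ j ∈ Finset.range (l₂ + 1),
        MvPolynomial.C (g₂.coeff j) * MvPolynomial.X 1 ^ (k₂ * j)
          * MvPolynomial.X 0 ^ (k₁ * (l₂ - j)))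
    (hu : u = G₁) (hv : v = MvPolynomial.X 0 * MvPolynomial.X 1 * G₂) :
    ∀ s : ℂ, MvPolynomial.eval ![s ^ k₂, s ^ k₁] u = s ^ d₂ ∧
      MvPolynomial.eval ![s ^ k₂, s ^ k₁] v = s ^ d₁ := by
  subst hd₁ hd₂ hu hv hG₁ hG₂
  refine fun s => ⟨eval_weighted_homogenization k₁ k₂ l₁ g₁ hdeg₁ hg₁1 s, ?_⟩
  rw [map_mul, eval_weighted_homogenization k₁ k₂ l₂ g₂ hdeg₂ hg₂1 s]
  simp only [map_mul, MvPolynomial.eval_X, Matrix.cons_val_zero, Matrix.cons_val_one]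
  ring
end

section
/- Let k₁,k₂ ≥ 1 and l₁,l₂ ≥ 0 be integers with k₁+l₂ > 1, k₂+l₁ > 1, gcd(k₁,k₂) = 1 and gcd(m₁,m₂) = 1, where m₁ = k₂l₂+1 and m₂ = k₁l₁+1; set d₁ = k₁m₁, d₂ = k₂m₂ and n = l₁+l₂+1. Then there exist polynomials g₁,g₂ ∈ ℂ[t] and μ ∈ ℂ, μ ≠ 0, such that: deg gᵢ = lᵢ, gᵢ(0) ≠ 0, gᵢ(1) = 1, g₁ and g₂ are squarefree and coprime, and m₂·g₁g₂ − d₁·t·g₁′·g₂ + d₂·t·g₁·g₂′ = μ·(t−1)^{n−1} in ℂ[t]. -/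
/-- Over `ℂ`, fewer polynomials than variables, all vanishing at the origin, have a common zero
different from the origin. -/
theorem exists_ne_zero_forall_eval_eq_zero {σ κ : Type} [Fintype σ] [Fintype κ]
    (hcard : Fintype.card κ < Fintype.card σ) (f : κ → MvPolynomial σ ℂ)
    (hf : ∀ k, MvPolynomial.eval 0 (f k) = 0) :
    ∃ x : σ → ℂ, x ≠ 0 ∧ ∀ k, MvPolynomial.eval x (f k) = 0 := by
  classical
  by_contra! hcon
  have hle : ringKrullDim (MvPolynomial σ ℂ) ≤ (Fintype.card κ : ℕ) := by
    rw [ringKrullDim_le_iff_isMaximal_height_le]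
    intro m hm
    obtain ⟨a, rfl⟩ := MvPolynomial.isMaximal_iff_eq_vanishingIdeal_singleton.1 hm
    let g : κ → MvPolynomial σ ℂ := fun k ↦
      MvPolynomial.bind₁ (fun i ↦ MvPolynomial.X i - MvPolynomial.C (a i)) (f k)
    have hg : ∀ k x, MvPolynomial.eval x (g k) = MvPolynomial.eval (x - a) (f k) := by
      intro k x
      change MvPolynomial.eval x (MvPolynomial.bind₁ _ (f k)) = _
      rw [← MvPolynomial.coe_aeval_eq_eval, RingHom.coe_coe, MvPolynomial.aeval_bind₁,
        ← MvPolynomial.coe_aeval_eq_eval, RingHom.coe_coe]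
      congr 2
      ext i
      simp
    let s : Finset (MvPolynomial σ ℂ) := Finset.univ.image g
    have hlocus : MvPolynomial.zeroLocus ℂ (Ideal.span (s : Set (MvPolynomial σ ℂ))) = {a} := by
      rw [MvPolynomial.zeroLocus_span]
      ext x
      simp only [s, Finset.coe_image, Finset.coe_univ, Set.image_univ, Set.mem_range,
        forall_exists_index, forall_apply_eq_imp_iff, Set.mem_ofPred_eq, Set.mem_singleton_iff,
        MvPolynomial.aeval_eq_eval, hg]
      constructor
      · intro h
        by_contra hxa
        obtain ⟨k, hk⟩ := hcon (x - a) (sub_ne_zero.2 hxa)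
        exact hk (h k)
      · rintro rfl k
        simpa using hf k
    have hrad := MvPolynomial.vanishingIdeal_zeroLocus_eq_radical (K := ℂ)
      (Ideal.span (s : Set (MvPolynomial σ ℂ)))
    rw [hlocus] at hrad
    have hmin : MvPolynomial.vanishingIdeal ℂ {a} ∈
        (Ideal.span (s : Set (MvPolynomial σ ℂ))).minimalPrimes := by
      refine ⟨⟨hm.isPrime, hrad ▸ Ideal.le_radical⟩, ?_⟩
      rintro q ⟨hq, hsq⟩ -
      rw [hrad]
      exact hq.radical_le_iff.2 hsq
    have hheight : (MvPolynomial.vanishingIdeal ℂ {a}).height ≤ (Fintype.card κ : ℕ∞) :=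
      (Ideal.height_le_card_of_mem_minimalPrimes_span_finset hmin).trans
        (by exact_mod_cast Finset.card_image_le)
    exact WithBot.coe_le_coe.2 hheight
  rw [MvPolynomial.ringKrullDim_of_isNoetherianRing, ringKrullDim_eq_zero_of_field, zero_add,
    Nat.card_eq_fintype_card] at hle
  exact absurd (by exact_mod_cast hle) (not_le.2 hcard)

/-- If no nonempty subfamily of `r` has zero sum, then the weighted power sums
`∑ i, r i * p i ^ k` for `1 ≤ k < card ι` vanish at some family `p` of distinct nonzero numbers. -/
theorem exists_injective_weighted_power_sums_eq_zero {ι : Type} [Fintype ι] [Nonempty ι]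
    (r : ι → ℂ) (hr : ∀ s : Finset ι, s.Nonempty → ∑ i ∈ s, r i ≠ 0) :
    ∃ p : ι → ℂ, Function.Injective p ∧ (∀ i, p i ≠ 0) ∧
      ∀ k, k + 1 < Fintype.card ι → ∑ i, r i * p i ^ (k + 1) = 0 := by
  classical
  have hpos : 0 < Fintype.card ι := Fintype.card_pos
  obtain ⟨p, hp0, hp⟩ := exists_ne_zero_forall_eval_eq_zero (σ := ι)
    (κ := Fin (Fintype.card ι - 1)) (by rw [Fintype.card_fin]; omega)
    (fun k ↦ ∑ i, MvPolynomial.C (r i) * MvPolynomial.X i ^ ((k : ℕ) + 1)) (by simp)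
  have hsum : ∀ k, k + 1 < Fintype.card ι → ∑ i, r i * p i ^ (k + 1) = 0 := fun k hk ↦ by
    simpa using hp ⟨k, by omega⟩
  let V : Finset ℂ := (Finset.univ.image p).erase 0
  have hVne : V.Nonempty := by
    obtain ⟨i, hi⟩ := Function.ne_iff.1 hp0
    exact ⟨p i, Finset.mem_erase.2 ⟨hi, Finset.mem_image_of_mem _ (Finset.mem_univ _)⟩⟩
  have hVcard : Fintype.card ι ≤ V.card := by
    by_contra! hlt
    obtain ⟨v, hv⟩ := hVne
    have hv0 : v ≠ 0 := (Finset.mem_erase.1 hv).1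
    let q : Polynomial ℂ := ∏ w ∈ V.erase v, (Polynomial.X - Polynomial.C w)
    have hqdeg : q.natDegree + 1 < Fintype.card ι := by
      rw [Polynomial.natDegree_prod_of_monic _ _ fun w _ ↦ Polynomial.monic_X_sub_C w]
      simp only [Polynomial.natDegree_X_sub_C, Finset.sum_const, smul_eq_mul, mul_one]
      rw [Finset.card_erase_add_one hv]
      exact hlt
    have hzero : ∑ i, r i * (p i * q.eval (p i)) = 0 := by
      simp_rw [Polynomial.eval_eq_sum_range, Finset.mul_sum]
      rw [Finset.sum_comm]
      refine Finset.sum_eq_zero fun k hk ↦ ?_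
      have hk' : k + 1 < Fintype.card ι := by
        have := Finset.mem_range.1 hk
        omega
      rw [← mul_zero (q.coeff k), ← hsum k hk', Finset.mul_sum]
      exact Finset.sum_congr rfl fun i _ ↦ by ring
    have hqv : q.eval v ≠ 0 := by
      rw [Polynomial.eval_prod, Finset.prod_ne_zero_iff]
      intro w hw
      simpa [sub_eq_zero] using (Finset.ne_of_mem_erase hw).symm
    have hcluster : ∑ i, r i * (p i * q.eval (p i)) =
        (∑ i ∈ Finset.univ.filter (fun i ↦ p i = v), r i) * (v * q.eval v) := by
      rw [Finset.sum_mul, Finset.sum_filter]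
      refine Finset.sum_congr rfl fun i _ ↦ ?_
      split_ifs with hi
      · rw [hi]
      · by_cases hi0 : p i = 0
        · simp [hi0]
        · have : q.eval (p i) = 0 := by
            rw [Polynomial.eval_prod]
            exact Finset.prod_eq_zero (i := p i) (Finset.mem_erase.2 ⟨hi, Finset.mem_erase.2
              ⟨hi0, Finset.mem_image_of_mem _ (Finset.mem_univ _)⟩⟩) (by simp)
          simp [this]
    rw [hcluster] at hzero
    refine hr _ ?_ ((mul_eq_zero.1 hzero).resolve_right (mul_ne_zero hv0 hqv))
    obtain ⟨i, -, hi⟩ := Finset.mem_image.1 (Finset.mem_of_mem_erase hv)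
    exact ⟨i, by simpa using hi⟩
  have himage : (Finset.univ.image p).card ≤ Fintype.card ι := Finset.card_image_le
  have hVle : V.card ≤ (Finset.univ.image p).card := Finset.card_le_card (Finset.erase_subset _ _)
  refine ⟨p, ?_, fun i hi ↦ ?_, hsum⟩
  · have : (Finset.univ.image p).card = (Finset.univ : Finset ι).card := by
      rw [Finset.card_univ]; omega
    simpa [Set.injOn_univ] using Finset.card_image_iff.1 this
  · have hmem : (0 : ℂ) ∈ Finset.univ.image p := Finset.mem_image.2 ⟨i, Finset.mem_univ _, hi⟩
    have : V.card < (Finset.univ.image p).card := Finset.card_erase_lt_of_mem hmem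
    omega

/-- The affine polynomial `1 + a (X - 1)`, which takes the value `1` at `1`. -/
noncomputable def unitAtOneLinear (a : ℂ) : Polynomial ℂ :=
  1 + Polynomial.C a * (Polynomial.X - 1)

section unitAtOneLinear

open Polynomial

theorem unitAtOneLinear_eq (a : ℂ) : unitAtOneLinear a = C a * X + C (1 - a) := by
  simp only [unitAtOneLinear, C_sub, C_1]
  ring

theorem eval_unitAtOneLinear (a x : ℂ) : (unitAtOneLinear a).eval x = 1 + a * (x - 1) := by
  simp [unitAtOneLinear]

theorem derivative_unitAtOneLinear (a : ℂ) : derivative (unitAtOneLinear a) = C a := by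
  simp [unitAtOneLinear_eq]

theorem unitAtOneLinear_ne_zero (a : ℂ) : unitAtOneLinear a ≠ 0 := fun h ↦ by
  simpa [h] using eval_unitAtOneLinear a 1

theorem natDegree_unitAtOneLinear {a : ℂ} (ha : a ≠ 0) : (unitAtOneLinear a).natDegree = 1 := by
  rw [unitAtOneLinear_eq, natDegree_linear ha]

theorem isCoprime_unitAtOneLinear {a b : ℂ} (hab : a ≠ b) :
    IsCoprime (unitAtOneLinear a) (unitAtOneLinear b) := by
  refine ⟨C (b / (b - a)), C (-a / (b - a)), ?_⟩
  have h : b - a ≠ 0 := sub_ne_zero.2 hab.symm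
  apply Polynomial.funext
  intro x
  simp only [eval_add, eval_mul, eval_C, eval_unitAtOneLinear, eval_one]
  field_simp
  ring

theorem separable_unitAtOneLinear {a : ℂ} (ha : a ≠ 0) : (unitAtOneLinear a).Separable := by
  rw [Separable, derivative_unitAtOneLinear]
  exact isCoprime_one_right.of_isCoprime_of_dvd_right
    (isUnit_iff_dvd_one.1 (isUnit_C.2 ha.isUnit))

theorem squarefree_prod_unitAtOneLinear {ι : Type} [Fintype ι] {p : ι → ℂ}
    (hp : Function.Injective p) (hp0 : ∀ i, p i ≠ 0) :
    Squarefree (∏ i, unitAtOneLinear (p i)) :=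
  (separable_prod (fun _ _ hij ↦ isCoprime_unitAtOneLinear (hp.ne hij))
    fun i ↦ separable_unitAtOneLinear (hp0 i)).squarefree

theorem natDegree_prod_unitAtOneLinear {ι : Type} (s : Finset ι) {p : ι → ℂ}
    (hp0 : ∀ i, p i ≠ 0) : (∏ i ∈ s, unitAtOneLinear (p i)).natDegree = s.card := by
  rw [natDegree_prod _ _ fun i _ ↦ unitAtOneLinear_ne_zero _]
  simp [natDegree_unitAtOneLinear (hp0 _)]

/-- If the weighted power sums of exponents `1, …, card ι - 1` of distinct nonzero `p i` vanish,
the numerator of the corresponding sum of simple fractions has a single zero, at `1`. -/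
theorem exists_sum_mul_prod_erase_eq {ι : Type} [Fintype ι] [Nonempty ι] [DecidableEq ι]
    {r p : ι → ℂ} (hr : ∀ i, r i ≠ 0) (hp : Function.Injective p) (hp0 : ∀ i, p i ≠ 0)
    (hsum : ∀ k, k + 1 < Fintype.card ι → ∑ i, r i * p i ^ (k + 1) = 0) :
    ∃ μ : ℂ, μ ≠ 0 ∧
      ∑ i, C (r i * p i) * ∏ j ∈ Finset.univ.erase i, unitAtOneLinear (p j) =
        C μ * (X - 1) ^ (Fintype.card ι - 1) := by
  set N := Fintype.card ι - 1 with hN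
  set F := ∑ i, C (r i * p i) * ∏ j ∈ Finset.univ.erase i, unitAtOneLinear (p j) with hF
  have hdvd : (X - 1) ^ N ∣ F := by
    have hgeom : ∀ i, ∏ j ∈ Finset.univ.erase i, unitAtOneLinear (p j) =
        (∏ j, unitAtOneLinear (p j)) * ∑ k ∈ Finset.range N, (-(C (p i) * (X - 1))) ^ k +
          (X - 1) ^ N * (C ((-p i) ^ N) * ∏ j ∈ Finset.univ.erase i, unitAtOneLinear (p j)) := by
      intro i
      rw [← Finset.mul_prod_erase _ _ (Finset.mem_univ i)]
      have h := mul_neg_geom_sum (-(C (p i) * (X - 1))) N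
      have h1 : (-(C (p i) * (X - 1))) ^ N = (X - 1) ^ N * C ((-p i) ^ N) := by
        rw [C_pow, C_neg, ← mul_pow]
        ring
      rw [h1, sub_neg_eq_add] at h
      simp only [unitAtOneLinear] at h ⊢
      linear_combination (-(∏ j ∈ Finset.univ.erase i, (1 + C (p j) * (X - 1)))) * h
    have hvanish : ∑ i, C (r i * p i) * ((∏ j, unitAtOneLinear (p j)) *
        ∑ k ∈ Finset.range N, (-(C (p i) * (X - 1))) ^ k) = 0 := by
      simp_rw [Finset.mul_sum]
      rw [Finset.sum_comm]
      refine Finset.sum_eq_zero fun k hk ↦ ?_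
      have hk' : k + 1 < Fintype.card ι := by
        have := Finset.mem_range.1 hk
        omega
      have h0 := congrArg (C : ℂ → ℂ[X]) (hsum k hk')
      rw [map_sum, C_0] at h0
      rw [← mul_zero ((∏ j, unitAtOneLinear (p j)) * (-(X - 1)) ^ k), ← h0, Finset.mul_sum]
      refine Finset.sum_congr rfl fun i _ ↦ ?_
      simp only [C_mul, C_pow]
      rw [← mul_neg, mul_pow]
      ring
    rw [hF, Finset.sum_congr rfl fun i _ ↦ congrArg (C (r i * p i) * ·) (hgeom i)]
    simp only [mul_add]
    rw [Finset.sum_add_distrib, hvanish, zero_add]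
    exact Finset.dvd_sum fun i _ ↦ (dvd_mul_right _ _).mul_left _
  have hdeg : F.natDegree ≤ N := by
    refine natDegree_sum_le_of_forall_le _ _ fun i _ ↦ (natDegree_C_mul_le _ _).trans ?_
    rw [natDegree_prod_unitAtOneLinear _ hp0, Finset.card_erase_of_mem (Finset.mem_univ i),
      Finset.card_univ]
  have hFne : F ≠ 0 := by
    obtain ⟨i⟩ := ‹Nonempty ι›
    intro h0
    have heval : F.eval (1 - (p i)⁻¹) = 0 := by rw [h0, eval_zero]
    rw [hF, eval_finsetSum, Finset.sum_eq_single i] at heval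
    · rw [eval_mul, eval_C, eval_prod] at heval
      refine mul_ne_zero (mul_ne_zero (hr i) (hp0 i)) (Finset.prod_ne_zero_iff.2 ?_) heval
      intro j hj h
      rw [eval_unitAtOneLinear] at h
      have hi := hp0 i
      field_simp at h
      exact Finset.ne_of_mem_erase hj (hp (by linear_combination -h))
    · intro j _ hji
      rw [eval_mul, eval_prod, Finset.prod_eq_zero (i := i), mul_zero]
      · exact Finset.mem_erase.2 ⟨hji.symm, Finset.mem_univ i⟩
      · rw [eval_unitAtOneLinear]
        have hi := hp0 i
        field_simp
        ring
    · simp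
  obtain ⟨q, hq⟩ := hdvd
  have hqne : q ≠ 0 := fun h ↦ hFne (by rw [hq, h, mul_zero])
  have hmonic : ((X - 1 : ℂ[X]) ^ N).Monic := (monic_X_sub_C (1 : ℂ)).pow N
  have hqdeg : q.natDegree = 0 := by
    have h1 : ((X - 1 : ℂ[X]) ^ N).natDegree = N := by
      rw [natDegree_pow, ← C_1, natDegree_X_sub_C, mul_one]
    rw [hq, hmonic.natDegree_mul' hqne, h1] at hdeg
    omega
  rw [eq_C_of_natDegree_eq_zero hqdeg] at hq hqne
  exact ⟨q.coeff 0, fun h ↦ hqne (by rw [h, C_0]), by rw [hq, mul_comm]⟩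

end unitAtOneLinear

/-- The multiset of weights `m₂`, `l₂` times `d₂` and `l₁` times `-d₁` has no nonempty
zero-sum submultiset. -/
theorem eq_zero_of_weight_balance {k₁ k₂ l₁ l₂ e a b : ℕ} (hk₂ : 1 ≤ k₂)
    (hk₁ : 1 ≤ k₁) (hcop : Nat.gcd (k₂ * l₂ + 1) (k₁ * l₁ + 1) = 1)
    (hb : b ≤ l₁)
    (h : e * (k₁ * l₁ + 1) + a * (k₂ * (k₁ * l₁ + 1)) = b * (k₁ * (k₂ * l₂ + 1))) :
    e = 0 ∧ a = 0 ∧ b = 0 := by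
  have hdvd : k₂ * l₂ + 1 ∣ e + a * k₂ := by
    refine Nat.Coprime.dvd_of_dvd_mul_right hcop ⟨b * k₁, ?_⟩
    linarith
  obtain ⟨c, hc⟩ := hdvd
  have hc' : c * (k₁ * l₁ + 1) = b * k₁ := by
    have hpos : 0 < k₂ * l₂ + 1 := Nat.succ_pos _
    refine Nat.eq_of_mul_eq_mul_left hpos ?_
    calc (k₂ * l₂ + 1) * (c * (k₁ * l₁ + 1)) = (k₂ * l₂ + 1) * c * (k₁ * l₁ + 1) := by ring
      _ = (k₂ * l₂ + 1) * (b * k₁) := by rw [← hc]; linarith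
  have hc0 : c = 0 := by
    by_contra hne
    have h1 : 1 ≤ c := Nat.one_le_iff_ne_zero.2 hne
    nlinarith [Nat.mul_le_mul_right k₁ hb, Nat.mul_le_mul_right (k₁ * l₁ + 1) h1]
  subst hc0
  have h1 : b * k₁ = 0 := by rw [← hc', zero_mul]
  have h2 : a * k₂ = 0 := by omega
  refine ⟨by omega, ?_, ?_⟩
  · exact (Nat.mul_eq_zero.1 h2).resolve_right (by omega)
  · exact (Nat.mul_eq_zero.1 h1).resolve_right (by omega)

/-- The weights `m₂` (once), `-d₁` (`l₁` times) and `d₂` (`l₂` times). -/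
def residueWeight (l₁ l₂ m₂ d₁ d₂ : ℕ) : Option (Fin l₁ ⊕ Fin l₂) → ℂ
  | none => m₂
  | some (Sum.inl _) => -d₁
  | some (Sum.inr _) => d₂

theorem sum_residueWeight_ne_zero {k₁ k₂ l₁ l₂ : ℕ} (hk₁ : 1 ≤ k₁) (hk₂ : 1 ≤ k₂)
    (hcop : Nat.gcd (k₂ * l₂ + 1) (k₁ * l₁ + 1) = 1)
    (s : Finset (Option (Fin l₁ ⊕ Fin l₂))) (hs : s.Nonempty) :
    ∑ i ∈ s, residueWeight l₁ l₂ (k₁ * l₁ + 1) (k₁ * (k₂ * l₂ + 1)) (k₂ * (k₁ * l₁ + 1)) i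
      ≠ 0 := by
  classical
  intro h
  set e : ℕ := if none ∈ s then 1 else 0 with he
  set B := Finset.univ.filter (fun j : Fin l₁ ↦ some (Sum.inl j) ∈ s) with hB
  set A := Finset.univ.filter (fun j : Fin l₂ ↦ some (Sum.inr j) ∈ s) with hA
  have hbal : e * (k₁ * l₁ + 1) + A.card * (k₂ * (k₁ * l₁ + 1)) =
      B.card * (k₁ * (k₂ * l₂ + 1)) := by
    rw [← Finset.univ_inter s, ← Finset.sum_ite_mem, Fintype.sum_option, Fintype.sum_sum_type] at h
    simp only [residueWeight] at h
    rw [← Finset.sum_filter, ← Finset.sum_filter, Finset.sum_const, Finset.sum_const, ← hA, ← hB,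
      nsmul_eq_mul, nsmul_eq_mul] at h
    have he' : (if none ∈ s then ((k₁ * l₁ + 1 : ℕ) : ℂ) else 0) =
        (e : ℂ) * ((k₁ * l₁ + 1 : ℕ) : ℂ) := by
      rw [he]; split_ifs <;> simp
    rw [he'] at h
    have : ((e * (k₁ * l₁ + 1) + A.card * (k₂ * (k₁ * l₁ + 1)) : ℕ) : ℂ) =
        ((B.card * (k₁ * (k₂ * l₂ + 1)) : ℕ) : ℂ) := by
      push_cast at h ⊢
      linear_combination h
    exact_mod_cast this
  obtain ⟨he0, hA0, hB0⟩ := eq_zero_of_weight_balance hk₂ hk₁ hcop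
    (B.card_le_univ.trans_eq (Fintype.card_fin _)) hbal
  rw [Finset.card_eq_zero, Finset.filter_eq_empty_iff] at hA0 hB0
  obtain ⟨i, hi⟩ := hs
  match i with
  | none => simp [he, hi] at he0
  | some (Sum.inl j) => exact hB0 (Finset.mem_univ j) hi
  | some (Sum.inr j) => exact hA0 (Finset.mem_univ j) hi

theorem residueWeight_ne_zero {l₁ l₂ m₂ d₁ d₂ : ℕ} (hm₂ : m₂ ≠ 0) (hd₁ : d₁ ≠ 0) (hd₂ : d₂ ≠ 0)
    (i : Option (Fin l₁ ⊕ Fin l₂)) : residueWeight l₁ l₂ m₂ d₁ d₂ i ≠ 0 := by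
  match i with
  | none => simpa [residueWeight] using hm₂
  | some (Sum.inl j) => simpa [residueWeight] using hd₁
  | some (Sum.inr j) => simpa [residueWeight] using hd₂

open Polynomial in
/-- The numerator of the sum of simple fractions with the weights `residueWeight`, in terms of the
products of the linear factors of each kind. -/
theorem sum_residueWeight_mul_prod_erase {l₁ l₂ m₂ d₁ d₂ : ℕ}
    {p : Option (Fin l₁ ⊕ Fin l₂) → ℂ} (hp : p none = 1) {g₁ g₂ : ℂ[X]}
    (hg₁ : g₁ = ∏ j, unitAtOneLinear (p (some (Sum.inl j))))
    (hg₂ : g₂ = ∏ j, unitAtOneLinear (p (some (Sum.inr j)))) :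
    ∑ i, C (residueWeight l₁ l₂ m₂ d₁ d₂ i * p i) *
        ∏ j ∈ Finset.univ.erase i, unitAtOneLinear (p j) =
      C (m₂ : ℂ) * (g₁ * g₂) - C (d₁ : ℂ) * X * derivative g₁ * g₂ +
        C (d₂ : ℂ) * X * g₁ * derivative g₂ := by
  have hX : unitAtOneLinear (p none) = X := by simp [unitAtOneLinear_eq, hp]
  have hP : ∏ j, unitAtOneLinear (p j) = X * (g₁ * g₂) := by
    rw [Fintype.prod_option, Fintype.prod_sum_type, hX, hg₁, hg₂]
  have hcancel : ∀ i (q : ℂ[X]), unitAtOneLinear (p i) * q = X * (g₁ * g₂) →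
      ∏ j ∈ Finset.univ.erase i, unitAtOneLinear (p j) = q := by
    intro i q hq
    refine mul_left_cancel₀ (unitAtOneLinear_ne_zero (p i)) ?_
    rw [Finset.mul_prod_erase _ (fun j ↦ unitAtOneLinear (p j)) (Finset.mem_univ i), hP, hq]
  have hinl : ∀ j, ∏ i ∈ Finset.univ.erase (some (Sum.inl j)), unitAtOneLinear (p i) =
      X * (∏ i ∈ Finset.univ.erase j, unitAtOneLinear (p (some (Sum.inl i)))) * g₂ := by
    refine fun j ↦ hcancel _ _ ?_
    rw [hg₁, ← Finset.mul_prod_erase _ _ (Finset.mem_univ j)]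
    ring
  have hinr : ∀ j, ∏ i ∈ Finset.univ.erase (some (Sum.inr j)), unitAtOneLinear (p i) =
      X * g₁ * (∏ i ∈ Finset.univ.erase j, unitAtOneLinear (p (some (Sum.inr i)))) := by
    refine fun j ↦ hcancel _ _ ?_
    rw [hg₂, ← Finset.mul_prod_erase _ _ (Finset.mem_univ j)]
    ring
  have hderiv₁ : derivative g₁ = ∑ j, (∏ i ∈ Finset.univ.erase j,
      unitAtOneLinear (p (some (Sum.inl i)))) * C (p (some (Sum.inl j))) := by
    rw [hg₁, derivative_prod_finset]
    simp only [derivative_unitAtOneLinear]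
  have hderiv₂ : derivative g₂ = ∑ j, (∏ i ∈ Finset.univ.erase j,
      unitAtOneLinear (p (some (Sum.inr i)))) * C (p (some (Sum.inr j))) := by
    rw [hg₂, derivative_prod_finset]
    simp only [derivative_unitAtOneLinear]
  rw [Fintype.sum_option, Fintype.sum_sum_type, hcancel none (g₁ * g₂) (by rw [hX]), hp, hderiv₁,
    hderiv₂]
  simp only [hinl, hinr, residueWeight, mul_one, Finset.mul_sum, Finset.sum_mul]
  rw [sub_eq_add_neg, ← Finset.sum_neg_distrib, add_assoc]
  refine congrArg₂ _ rfl (congrArg₂ _ ?_ ?_)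
  · refine Finset.sum_congr rfl fun j _ ↦ ?_
    simp only [C_mul, C_neg]
    ring
  · refine Finset.sum_congr rfl fun j _ ↦ ?_
    simp only [C_mul]
    ring

/-- Existence statement (Case (b) of the main theorem + Zannier's theorem): there exist
squarefree coprime polynomials `g₁, g₂` of degrees `l₁, l₂` with `gᵢ(0) ≠ 0`, `gᵢ(1) = 1`,
and `μ ≠ 0` satisfying `m₂·g₁g₂ - d₁·t·g₁'·g₂ + d₂·t·g₁·g₂' = μ·(t-1)^{n-1}`. -/
theorem stmt_6 (k₁ k₂ l₁ l₂ : ℕ) (hk₁ : 1 ≤ k₁) (hk₂ : 1 ≤ k₂)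
    (m₁ m₂ d₁ d₂ n : ℕ)
    (hm₁ : m₁ = k₂ * l₂ + 1) (hm₂ : m₂ = k₁ * l₁ + 1)
    (hd₁ : d₁ = k₁ * m₁) (hd₂ : d₂ = k₂ * m₂) (hn : n = l₁ + l₂ + 1)
    (h₁ : 1 < k₁ + l₂) (h₂ : 1 < k₂ + l₁)
    (hcop : Nat.gcd k₁ k₂ = 1) (hcop' : Nat.gcd m₁ m₂ = 1) :
    ∃ (g₁ g₂ : Polynomial ℂ) (μ : ℂ), μ ≠ 0 ∧
      g₁.natDegree = l₁ ∧ g₂.natDegree = l₂ ∧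
      g₁.eval 0 ≠ 0 ∧ g₂.eval 0 ≠ 0 ∧ g₁.eval 1 = 1 ∧ g₂.eval 1 = 1 ∧
      Squarefree g₁ ∧ Squarefree g₂ ∧ IsCoprime g₁ g₂ ∧
      Polynomial.C (m₂ : ℂ) * (g₁ * g₂)
          - Polynomial.C (d₁ : ℂ) * Polynomial.X * Polynomial.derivative g₁ * g₂
          + Polynomial.C (d₂ : ℂ) * Polynomial.X * g₁ * Polynomial.derivative g₂
        = Polynomial.C μ * (Polynomial.X - 1) ^ (n - 1) := by
  have hsub : ∀ s : Finset (Option (Fin l₁ ⊕ Fin l₂)), s.Nonempty →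
      ∑ i ∈ s, residueWeight l₁ l₂ m₂ d₁ d₂ i ≠ 0 := by
    subst hm₁ hm₂ hd₁ hd₂
    exact sum_residueWeight_ne_zero hk₁ hk₂ hcop'
  have hcard : Fintype.card (Option (Fin l₁ ⊕ Fin l₂)) = n := by simp [hn]
  obtain ⟨q, hqinj, hq0, hqsum⟩ := exists_injective_weighted_power_sums_eq_zero _ hsub
  obtain ⟨p, hp⟩ : ∃ p, p = fun i ↦ q i / q none := ⟨_, rfl⟩
  have hpnone : p none = 1 := by rw [hp]; exact div_self (hq0 none)
  have hpinj : Function.Injective p := fun i j hij ↦ by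
    rw [hp] at hij
    exact hqinj ((div_left_inj' (hq0 none)).1 hij)
  have hp0 : ∀ i, p i ≠ 0 := fun i ↦ by rw [hp]; exact div_ne_zero (hq0 i) (hq0 none)
  have hpsum : ∀ k, k + 1 < Fintype.card (Option (Fin l₁ ⊕ Fin l₂)) →
      ∑ i, residueWeight l₁ l₂ m₂ d₁ d₂ i * p i ^ (k + 1) = 0 := fun k hk ↦ by
    simp only [hp, div_pow, ← mul_div_assoc]
    rw [← Finset.sum_div, hqsum k hk, zero_div]
  have hm₂0 : m₂ ≠ 0 := by omega
  have hd₁0 : d₁ ≠ 0 := by rw [hd₁, hm₁]; positivity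
  have hd₂0 : d₂ ≠ 0 := by rw [hd₂, hm₂]; positivity
  obtain ⟨μ, hμ, hF⟩ := exists_sum_mul_prod_erase_eq (residueWeight_ne_zero hm₂0 hd₁0 hd₂0)
    hpinj hp0 hpsum
  rw [sum_residueWeight_mul_prod_erase hpnone rfl rfl, hcard] at hF
  have heval0 : ∀ i, i ≠ none → (unitAtOneLinear (p i)).eval 0 ≠ 0 := fun i hi h ↦ by
    rw [eval_unitAtOneLinear] at h
    exact hi (hpinj (by rw [hpnone]; linear_combination -h))
  refine ⟨_, _, μ, hμ, ?_, ?_, ?_, ?_, ?_, ?_, ?_, ?_, ?_, hF⟩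
  · rw [natDegree_prod_unitAtOneLinear _ fun _ ↦ hp0 _, Finset.card_univ, Fintype.card_fin]
  · rw [natDegree_prod_unitAtOneLinear _ fun _ ↦ hp0 _, Finset.card_univ, Fintype.card_fin]
  · rw [Polynomial.eval_prod]
    exact Finset.prod_ne_zero_iff.2 fun j _ ↦ heval0 _ (by simp)
  · rw [Polynomial.eval_prod]
    exact Finset.prod_ne_zero_iff.2 fun j _ ↦ heval0 _ (by simp)
  · simp [Polynomial.eval_prod, eval_unitAtOneLinear]
  · simp [Polynomial.eval_prod, eval_unitAtOneLinear]
  · exact squarefree_prod_unitAtOneLinear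
      (hpinj.comp ((Option.some_injective _).comp Sum.inl_injective)) fun _ ↦ hp0 _
  · exact squarefree_prod_unitAtOneLinear
      (hpinj.comp ((Option.some_injective _).comp Sum.inr_injective)) fun _ ↦ hp0 _
  · exact IsCoprime.prod_left fun i _ ↦ IsCoprime.prod_right fun j _ ↦
      isCoprime_unitAtOneLinear (hpinj.ne (by simp))
end

section
/- Let k₁,k₂,l ≥ 1 be integers, set α = l·k₁/(k₁+k₂) ∈ ℚ ⊂ ℂ, and let binom(α,j) = α(α−1)⋯(α−j+1)/j! denote the generalized binomial coefficient. Define u = Σ_{j=0}^{l} binom(α,j)·(y^{k₂} − x^{k₁})^j·x^{k₁(l−j)} and v = x·y in ℂ[x,y]. Then J(u,v) = (α−l)·(k₁+k₂)·binom(α,l)·(y^{k₂} − x^{k₁})^{l}. -/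
/-- Generalized binomial recurrence `(j + 1) binom(a, j + 1) = (a - j) binom(a, j)`. -/
lemma succ_mul_prod_range_sub_div_factorial (a : ℂ) (j : ℕ) :
    ((j : ℂ) + 1) * ((∏ i ∈ Finset.range (j + 1), (a - (i : ℂ))) / (Nat.factorial (j + 1) : ℂ))
      = (a - j) * ((∏ i ∈ Finset.range j, (a - (i : ℂ))) / (Nat.factorial j : ℂ)) := by
  have h1 : (Nat.factorial j : ℂ) ≠ 0 := Nat.cast_ne_zero.mpr (Nat.factorial_ne_zero j)
  have h2 : (j : ℂ) + 1 ≠ 0 := Nat.cast_add_one_ne_zero j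
  rw [Finset.prod_range_succ, Nat.factorial_succ]
  push_cast
  field_simp

/-- A derivation with `D p = κ p` and `D w = (κ - s) w - s p`, where `κ l = α s`, telescopes on
truncations of the homogenized binomial series `∑ c_j w ^ j p ^ (l - j)`. -/
lemma Derivation.map_sum_binomial_jet {R A : Type*} [CommRing R] [CommRing A] [Algebra R A]
    (D : Derivation R A A) {p w : A} {κ s α : R} {l : ℕ} {c : ℕ → R}
    (hp : D p = algebraMap R A κ * p)
    (hw : D w = algebraMap R A (κ - s) * w - algebraMap R A s * p)
    (hα : κ * l = α * s) (hc : ∀ j : ℕ, ((j : R) + 1) * c (j + 1) = (α - j) * c j)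
    {n : ℕ} (hn : n ≤ l) :
    D (∑ j ∈ Finset.range (n + 1), algebraMap R A (c j) * w ^ j * p ^ (l - j))
      = algebraMap R A ((α - n) * s * c n) * w ^ n * p ^ (l - n) := by
  induction n with
  | zero =>
    have h := congrArg (algebraMap R A) hα
    simp only [map_mul] at h
    rcases l with _ | l
    · simp at h ⊢
      simp [← h]
    · simp [Derivation.leibniz, Derivation.leibniz_pow, hp]
      push_cast at h
      linear_combination (algebraMap R A (c 0)) * p ^ (l + 1) * h
  | succ n ih =>
    obtain ⟨m, rfl⟩ := Nat.exists_eq_add_of_le hn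
    have h := congrArg (algebraMap R A) hα
    have h' := congrArg (algebraMap R A) (hc n)
    have e1 : n + 1 + m - n = m + 1 := by omega
    have e2 : n + 1 + m - (n + 1) = m := by omega
    have hpm : D (p ^ m) = m * algebraMap R A κ * p ^ m := by
      rcases m with _ | m
      · simp
      · simp [Derivation.leibniz_pow, hp]
        ring
    rw [Finset.sum_range_succ, map_add, ih (by omega), e1, e2]
    simp only [Derivation.leibniz, hpm, Derivation.leibniz_pow, hw, Derivation.map_algebraMap,
      smul_eq_mul, nsmul_eq_mul, Nat.add_sub_cancel]
    push_cast [map_mul, map_natCast, map_add, map_sub, map_one] at h h' ⊢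
    linear_combination (algebraMap R A (c (n + 1))) * w ^ (n + 1) * p ^ m * h
      - algebraMap R A s * w ^ n * p ^ (m + 1) * h'


/-- Explicit formula for the coverings of the first row of Table 1 (Case (a) with
`l₂ = 0`): with `u = Σ_{j=0}^{l} binom(α,j)·(y^{k₂}-x^{k₁})^j·x^{k₁(l-j)}` and `v = xy`,
`J(u,v) = (α-l)·(k₁+k₂)·binom(α,l)·(y^{k₂}-x^{k₁})^l`, where `α = l·k₁/(k₁+k₂)`. -/
theorem stmt_11 (k₁ k₂ l : ℕ) (hk₁ : 1 ≤ k₁) (hk₂ : 1 ≤ k₂) (hl : 1 ≤ l)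
    (α : ℂ) (hα : α = (l : ℂ) * k₁ / ((k₁ : ℂ) + k₂))
    (binom : ℂ → ℕ → ℂ)
    (hbinom : ∀ (a : ℂ) (j : ℕ),
      binom a j = (∏ i ∈ Finset.range j, (a - (i : ℂ))) / (Nat.factorial j : ℂ))
    (u v : MvPolynomial (Fin 2) ℂ)
    (hu : u = ∑ j ∈ Finset.range (l + 1),
        MvPolynomial.C (binom α j)
          * (MvPolynomial.X 1 ^ k₂ - MvPolynomial.X 0 ^ k₁) ^ j
          * MvPolynomial.X 0 ^ (k₁ * (l - j)))
    (hv : v = MvPolynomial.X 0 * MvPolynomial.X 1) :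
    MvPolynomial.pderiv 0 u * MvPolynomial.pderiv 1 v
      - MvPolynomial.pderiv 1 u * MvPolynomial.pderiv 0 v
      = MvPolynomial.C ((α - l) * ((k₁ : ℂ) + k₂) * binom α l)
        * (MvPolynomial.X 1 ^ k₂ - MvPolynomial.X 0 ^ k₁) ^ l := by
  have hs : (k₁ : ℂ) + k₂ ≠ 0 := by
    have : k₁ + k₂ ≠ 0 := by omega
    exact_mod_cast this
  let D : Derivation ℂ (MvPolynomial (Fin 2) ℂ) (MvPolynomial (Fin 2) ℂ) :=
    (MvPolynomial.X 0 : MvPolynomial (Fin 2) ℂ) • MvPolynomial.pderiv 0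
      - (MvPolynomial.X 1 : MvPolynomial (Fin 2) ℂ) • MvPolynomial.pderiv 1
  have hD : ∀ q, D q = MvPolynomial.X 0 * MvPolynomial.pderiv 0 q
      - MvPolynomial.X 1 * MvPolynomial.pderiv 1 q := fun _ => rfl
  have hX : D (MvPolynomial.X 0 ^ k₁)
      = algebraMap ℂ _ (k₁ : ℂ) * MvPolynomial.X 0 ^ k₁ := by
    obtain ⟨k, rfl⟩ := Nat.exists_eq_add_of_le' hk₁
    simp [hD, Derivation.leibniz_pow, MvPolynomial.pderiv_X]
    ring
  have hY : D (MvPolynomial.X 1 ^ k₂)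
      = -(algebraMap ℂ _ (k₂ : ℂ) * MvPolynomial.X 1 ^ k₂) := by
    obtain ⟨k, rfl⟩ := Nat.exists_eq_add_of_le' hk₂
    simp [hD, Derivation.leibniz_pow, MvPolynomial.pderiv_X]
    ring
  have key := D.map_sum_binomial_jet (p := MvPolynomial.X 0 ^ k₁)
    (w := MvPolynomial.X 1 ^ k₂ - MvPolynomial.X 0 ^ k₁) (κ := (k₁ : ℂ)) (s := (k₁ : ℂ) + k₂)
    (α := α) (l := l) (c := binom α) hX
    (by rw [map_sub, hX, hY]; simp only [map_sub, map_add]; ring)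
    (by rw [hα]; field_simp)
    (fun j => by rw [hbinom, hbinom]; exact succ_mul_prod_range_sub_div_factorial α j) le_rfl
  simp only [← pow_mul, MvPolynomial.algebraMap_eq, Nat.sub_self, pow_zero,
    mul_one] at key
  rw [← hu, hD] at key
  rw [← key, hv]
  simp [Derivation.leibniz, MvPolynomial.pderiv_X]
  ring
end

section
/- Define u = x³ + 9xy² + 9y³ and v = x⁵ + 15x³y² + 15x²y³ + 45xy⁴ + 90y⁵ in ℂ[x,y]. Then J(u,v) = 2835·y⁶, and for every t ∈ ℂ one has u(t,0) = t³ and v(t,0) = t⁵. -/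
/-- The exceptional covering of the third row of Table 1:
`u = x³ + 9xy² + 9y³`, `v = x⁵ + 15x³y² + 15x²y³ + 45xy⁴ + 90y⁵` has
`J(u,v) = 2835·y⁶` and `u(t,0) = t³`, `v(t,0) = t⁵`. -/
theorem stmt_13 (u v : MvPolynomial (Fin 2) ℂ)
    (hu : u = MvPolynomial.X 0 ^ 3
        + MvPolynomial.C (9 : ℂ) * MvPolynomial.X 0 * MvPolynomial.X 1 ^ 2
        + MvPolynomial.C (9 : ℂ) * MvPolynomial.X 1 ^ 3)
    (hv : v = MvPolynomial.X 0 ^ 5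
        + MvPolynomial.C (15 : ℂ) * MvPolynomial.X 0 ^ 3 * MvPolynomial.X 1 ^ 2
        + MvPolynomial.C (15 : ℂ) * MvPolynomial.X 0 ^ 2 * MvPolynomial.X 1 ^ 3
        + MvPolynomial.C (45 : ℂ) * MvPolynomial.X 0 * MvPolynomial.X 1 ^ 4
        + MvPolynomial.C (90 : ℂ) * MvPolynomial.X 1 ^ 5) :
    (MvPolynomial.pderiv 0 u * MvPolynomial.pderiv 1 v
        - MvPolynomial.pderiv 1 u * MvPolynomial.pderiv 0 v
      = MvPolynomial.C (2835 : ℂ) * MvPolynomial.X 1 ^ 6)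
    ∧ ∀ t : ℂ, MvPolynomial.eval ![t, 0] u = t ^ 3
        ∧ MvPolynomial.eval ![t, 0] v = t ^ 5 := by
  have h01 : MvPolynomial.pderiv (0 : Fin 2) (MvPolynomial.X 1 : MvPolynomial (Fin 2) ℂ) = 0 :=
    MvPolynomial.pderiv_X_of_ne (by decide)
  have h10 : MvPolynomial.pderiv (1 : Fin 2) (MvPolynomial.X 0 : MvPolynomial (Fin 2) ℂ) = 0 :=
    MvPolynomial.pderiv_X_of_ne (by decide)
  subst hu hv
  refine ⟨?_, fun t => by simp⟩
  simp only [map_add, MvPolynomial.pderiv_mul, MvPolynomial.pderiv_pow, MvPolynomial.pderiv_C,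
    MvPolynomial.pderiv_X_self, h01, h10]
  simp only [map_ofNat]
  push_cast
  ring
end

section
/- Let k₁,k₂ ≥ 1 be integers with gcd(k₁,k₂) = 1 and k₁k₂ ≥ 2, set d₁ = k₁+k₂+k₁k₂ and d₂ = k₁k₂, and let s ∈ ℂ satisfy s² = −d₁. Define A = (k₂·x^{k₁} + k₁·y^{k₂})/(k₁+k₂), B = (x^{k₁} − y^{k₂})/(k₁+k₂), u = A − d₂·B/s and v = x·y·(A + s·B) in ℂ[x,y]. Then there exists μ ∈ ℂ, μ ≠ 0, such that J(u,v) = μ·(y^{k₂} − x^{k₁})². -/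
open MvPolynomial in
/-- The Jacobian determinant of `aXᵐ⁺¹ + bYⁿ⁺¹` and `XY(cXᵐ⁺¹ + eYⁿ⁺¹)`, under conditions on the
coefficients that make it proportional to `(Yⁿ⁺¹ - Xᵐ⁺¹)²`. -/
theorem jacobian_eq_C_mul_sq {R : Type*} [CommRing R] (m n : ℕ) (a b c e μ : R)
    (h₁ : a * c * (m + 1) = μ) (h₂ : b * e * (n + 1) = -μ)
    (h₃ : a * e * (m + 1) * (n + 2) - b * c * (n + 1) * (m + 2) = -2 * μ)
    (u v : MvPolynomial (Fin 2) R)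
    (hu : u = C a * X 0 ^ (m + 1) + C b * X 1 ^ (n + 1))
    (hv : v = X 0 * X 1 * (C c * X 0 ^ (m + 1) + C e * X 1 ^ (n + 1))) :
    pderiv 0 u * pderiv 1 v - pderiv 1 u * pderiv 0 v
      = C μ * (X 1 ^ (n + 1) - X 0 ^ (m + 1)) ^ 2 := by
  have h₁' := congrArg (C (σ := Fin 2)) h₁
  have h₂' := congrArg (C (σ := Fin 2)) h₂
  have h₃' := congrArg (C (σ := Fin 2)) h₃
  simp only [map_mul, map_add, map_sub, map_neg, map_natCast, map_one, map_ofNat] at h₁' h₂' h₃'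
  have h01 : pderiv (R := R) (0 : Fin 2) (X 1) = 0 := pderiv_X_of_ne (by decide)
  have h10 : pderiv (R := R) (1 : Fin 2) (X 0) = 0 := pderiv_X_of_ne (by decide)
  subst hu hv
  simp only [map_add, pderiv_mul, pderiv_pow, pderiv_C, pderiv_X_self, h01, h10,
    Nat.add_sub_cancel, Nat.cast_add, Nat.cast_one]
  linear_combination (X 0 ^ (m + 1)) ^ 2 * h₁' - (X 1 ^ (n + 1)) ^ 2 * h₂'
    + X 0 ^ (m + 1) * X 1 ^ (n + 1) * h₃'


/-- Explicit formula in Case (a) with `l₁ = l₂ = 1` (ramification order 3 along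
`x^{k₁} = y^{k₂}`): `u = A - d₂B/s`, `v = xy(A + sB)` with `s² = -d₁` has Jacobian
`μ·(y^{k₂} - x^{k₁})²` for some `μ ≠ 0`. -/
theorem stmt_14 (k₁ k₂ : ℕ) (hk₁ : 1 ≤ k₁) (hk₂ : 1 ≤ k₂)
    (hcop : Nat.gcd k₁ k₂ = 1) (hbig : 2 ≤ k₁ * k₂)
    (d₁ d₂ : ℕ) (hd₁ : d₁ = k₁ + k₂ + k₁ * k₂) (hd₂ : d₂ = k₁ * k₂)
    (s : ℂ) (hs : s ^ 2 = -(d₁ : ℂ))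
    (A B u v : MvPolynomial (Fin 2) ℂ)
    (hA : A = MvPolynomial.C (((k₁ : ℂ) + k₂)⁻¹)
        * (MvPolynomial.C (k₂ : ℂ) * MvPolynomial.X 0 ^ k₁
            + MvPolynomial.C (k₁ : ℂ) * MvPolynomial.X 1 ^ k₂))
    (hB : B = MvPolynomial.C (((k₁ : ℂ) + k₂)⁻¹)
        * (MvPolynomial.X 0 ^ k₁ - MvPolynomial.X 1 ^ k₂))
    (hu : u = A - MvPolynomial.C ((d₂ : ℂ) / s) * B)
    (hv : v = MvPolynomial.X 0 * MvPolynomial.X 1 * (A + MvPolynomial.C s * B)) :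
    ∃ μ : ℂ, μ ≠ 0 ∧
      MvPolynomial.pderiv 0 u * MvPolynomial.pderiv 1 v
        - MvPolynomial.pderiv 1 u * MvPolynomial.pderiv 0 v
        = MvPolynomial.C μ * (MvPolynomial.X 1 ^ k₂ - MvPolynomial.X 0 ^ k₁) ^ 2 := by
  obtain ⟨m, rfl⟩ := Nat.exists_eq_add_of_le' hk₁
  obtain ⟨n, rfl⟩ := Nat.exists_eq_add_of_le' hk₂
  have hs0 : s ≠ 0 := by
    rintro rfl
    have h : ((d₁ : ℕ) : ℂ) = 0 := by linear_combination hs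
    have := Nat.cast_eq_zero.mp h
    omega
  have hm : (m : ℂ) + 1 ≠ 0 := by exact_mod_cast Nat.succ_ne_zero m
  have hn : (n : ℂ) + 1 ≠ 0 := by exact_mod_cast Nat.succ_ne_zero n
  have hK : ((m : ℂ) + 1 + (n + 1)) ≠ 0 := by
    have : m + 1 + (n + 1) ≠ 0 := by omega
    exact_mod_cast this
  have hsm : s - (m + 1) ≠ 0 := by
    intro h
    have h' : (((m + 1) ^ 2 + d₁ : ℕ) : ℂ) = 0 := by
      push_cast
      linear_combination hs - (s + (m + 1)) * h
    have := Nat.cast_eq_zero.mp h'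
    simp at this
  have hsn : s + (n + 1) ≠ 0 := by
    intro h
    have h' : (((n + 1) ^ 2 + d₁ : ℕ) : ℂ) = 0 := by
      push_cast
      linear_combination hs - (s - (n + 1)) * h
    have := Nat.cast_eq_zero.mp h'
    simp at this
  subst hd₁ hd₂
  push_cast at hs
  refine ⟨(m + 1) * (n + 1) * (s - (m + 1)) * (s + (n + 1)) / (s * (m + 1 + (n + 1)) ^ 2),
    by simp [hm, hn, hsm, hsn, hs0, hK], ?_⟩
  refine jacobian_eq_C_mul_sq m n
    ((n + 1) * (s - (m + 1)) / (s * (m + 1 + (n + 1))))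
    ((m + 1) * (s + (n + 1)) / (s * (m + 1 + (n + 1))))
    ((n + 1 + s) / (m + 1 + (n + 1))) ((m + 1 - s) / (m + 1 + (n + 1))) _ ?_ ?_ ?_ u v ?_ ?_
  · field_simp
    ring
  · field_simp
    ring
  · field_simp
    linear_combination (-(m + 1 + (n + 1) : ℂ)) * hs
  · have ha : ((n : ℂ) + 1) * (s - (m + 1)) / (s * (m + 1 + (n + 1)))
        = (m + 1 + (n + 1) : ℂ)⁻¹ * (n + 1) - (m + 1) * (n + 1) / s * (m + 1 + (n + 1) : ℂ)⁻¹ := by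
      field_simp
    have hb : ((m : ℂ) + 1) * (s + (n + 1)) / (s * (m + 1 + (n + 1)))
        = (m + 1 + (n + 1) : ℂ)⁻¹ * (m + 1) + (m + 1) * (n + 1) / s * (m + 1 + (n + 1) : ℂ)⁻¹ := by
      field_simp
    rw [hu, hA, hB, ha, hb]
    push_cast
    simp only [map_mul, map_add, map_sub]
    ring
  · rw [hv, hA, hB]
    push_cast
    simp only [div_eq_mul_inv, map_mul, map_add, map_sub]
    ring
end

section
/- Let k₁,k₂ ≥ 1 be integers with gcd(k₁,k₂) = 1, k₁ ≠ k₂, and gcd(k₂+1, k₁+1) = 1. Let s ∈ ℂ satisfy s² = k₁k₂, and set a = (k₁+1)(k₁+s)/(k₁(k₁−k₂)) and b = (k₂+1)(k₂+s)/(k₂(k₂−k₁)). Define u = x·(a·y^{k₂} + (1−a)·x^{k₁}) and v = y·(b·x^{k₁} + (1−b)·y^{k₂}) in ℂ[x,y]. Then there exists μ ∈ ℂ, μ ≠ 0, such that J(u,v) = μ·(y^{k₂} − x^{k₁})². -/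
open MvPolynomial in
/-- The Jacobian of `x(a·y^q + c·x^p)` and `y(b·x^p + d·y^q)` as a quadratic form in
`x^p` and `y^q`. -/
lemma jacobian_eq_quadratic_form (p q : ℕ) (a b c d : ℂ) :
    pderiv 0 (X 0 * (C a * X 1 ^ q + C c * X 0 ^ p) : MvPolynomial (Fin 2) ℂ)
        * pderiv 1 (X 1 * (C b * X 0 ^ p + C d * X 1 ^ q) : MvPolynomial (Fin 2) ℂ)
      - pderiv 1 (X 0 * (C a * X 1 ^ q + C c * X 0 ^ p) : MvPolynomial (Fin 2) ℂ)
        * pderiv 0 (X 1 * (C b * X 0 ^ p + C d * X 1 ^ q) : MvPolynomial (Fin 2) ℂ)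
      = C (a * d * (q + 1)) * (X 1 ^ q) ^ 2 + C (c * b * (p + 1)) * (X 0 ^ p) ^ 2
        + C (a * b * (1 - p * q) + c * d * (p + 1) * (q + 1)) * (X 0 ^ p * X 1 ^ q) := by
  have h01 : pderiv 0 (X 1 : MvPolynomial (Fin 2) ℂ) = 0 := pderiv_X_of_ne (by decide)
  have h10 : pderiv 1 (X 0 : MvPolynomial (Fin 2) ℂ) = 0 := pderiv_X_of_ne (by decide)
  rcases p with _ | p <;> rcases q with _ | q <;>
    simp [h01, h10] <;> ring


/-- Explicit formula in Case (b) with `l₁ = l₂ = 1` (ramification order 3 along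
`x^{k₁} = y^{k₂}`): `u = x(a·y^{k₂} + (1-a)·x^{k₁})`, `v = y(b·x^{k₁} + (1-b)·y^{k₂})`
with `s² = k₁k₂` has Jacobian `μ·(y^{k₂} - x^{k₁})²` for some `μ ≠ 0`. -/
theorem stmt_15 (k₁ k₂ : ℕ) (hk₁ : 1 ≤ k₁) (hk₂ : 1 ≤ k₂)
    (hne : k₁ ≠ k₂) (hcop : Nat.gcd k₁ k₂ = 1) (hcop' : Nat.gcd (k₂ + 1) (k₁ + 1) = 1)
    (s : ℂ) (hs : s ^ 2 = (k₁ : ℂ) * k₂)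
    (a b : ℂ)
    (ha : a = ((k₁ : ℂ) + 1) * ((k₁ : ℂ) + s) / ((k₁ : ℂ) * ((k₁ : ℂ) - k₂)))
    (hb : b = ((k₂ : ℂ) + 1) * ((k₂ : ℂ) + s) / ((k₂ : ℂ) * ((k₂ : ℂ) - k₁)))
    (u v : MvPolynomial (Fin 2) ℂ)
    (hu : u = MvPolynomial.X 0
        * (MvPolynomial.C a * MvPolynomial.X 1 ^ k₂
            + MvPolynomial.C (1 - a) * MvPolynomial.X 0 ^ k₁))
    (hv : v = MvPolynomial.X 1
        * (MvPolynomial.C b * MvPolynomial.X 0 ^ k₁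
            + MvPolynomial.C (1 - b) * MvPolynomial.X 1 ^ k₂)) :
    ∃ μ : ℂ, μ ≠ 0 ∧
      MvPolynomial.pderiv 0 u * MvPolynomial.pderiv 1 v
        - MvPolynomial.pderiv 1 u * MvPolynomial.pderiv 0 v
        = MvPolynomial.C μ * (MvPolynomial.X 1 ^ k₂ - MvPolynomial.X 0 ^ k₁) ^ 2 := by
  have hp : (k₁ : ℂ) ≠ 0 := Nat.cast_ne_zero.2 (by omega)
  have hq : (k₂ : ℂ) ≠ 0 := Nat.cast_ne_zero.2 (by omega)
  have hpq : (k₁ : ℂ) - k₂ ≠ 0 := sub_ne_zero.2 (Nat.cast_injective.ne hne)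
  have hqp : (k₂ : ℂ) - k₁ ≠ 0 := sub_ne_zero.2 (Nat.cast_injective.ne hne.symm)
  have hp1 : (k₁ : ℂ) + 1 ≠ 0 := Nat.cast_add_one_ne_zero k₁
  have hq1 : (k₂ : ℂ) + 1 ≠ 0 := Nat.cast_add_one_ne_zero k₂
  have hps : (k₁ : ℂ) + s ≠ 0 := fun h ↦
    mul_ne_zero hp hpq (by linear_combination hs + (k₁ - s) * h)
  have hqs : (k₂ : ℂ) + s ≠ 0 := fun h ↦
    mul_ne_zero hq hqp (by linear_combination hs + (k₂ - s) * h)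
  have hs1 : s + 1 ≠ 0 := fun h ↦ by
    have h1 : ((k₁ * k₂ : ℕ) : ℂ) = (1 : ℕ) := by
      push_cast
      linear_combination (s - 1) * h - hs
    have h2 := mul_eq_one.1 (Nat.cast_injective h1)
    omega
  have ha' : 1 - a = -((s + 1) * (k₁ + s)) / (k₁ * (k₁ - k₂)) := by
    rw [ha, eq_div_iff (mul_ne_zero hp hpq), sub_mul, div_mul_cancel₀ _ (mul_ne_zero hp hpq)]
    linear_combination hs
  have hb' : 1 - b = -((s + 1) * (k₂ + s)) / (k₂ * (k₂ - k₁)) := by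
    rw [hb, eq_div_iff (mul_ne_zero hq hqp), sub_mul, div_mul_cancel₀ _ (mul_ne_zero hq hqp)]
    linear_combination hs
  have hx : (1 - a) * b * (k₁ + 1) = a * (1 - b) * (k₂ + 1) := by
    rw [ha', hb', ha, hb]
    field_simp
  have hxy : a * b * (1 - k₁ * k₂) + (1 - a) * (1 - b) * (k₁ + 1) * (k₂ + 1)
      = -2 * (a * (1 - b) * (k₂ + 1)) := by
    rw [ha', hb', ha, hb, ← hs]
    field_simp
    ring
  refine ⟨a * (1 - b) * (k₂ + 1), ?_, ?_⟩
  · rw [hb', ha]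
    exact mul_ne_zero (mul_ne_zero
      (div_ne_zero (mul_ne_zero hp1 hps) (mul_ne_zero hp hpq))
      (div_ne_zero (neg_ne_zero.2 (mul_ne_zero hs1 hqs)) (mul_ne_zero hq hqp))) hq1
  · rw [hu, hv, jacobian_eq_quadratic_form, hx, hxy, MvPolynomial.C_mul (a := -2)]
    simp only [map_neg, map_ofNat]
    ring
end
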